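/- Let α be a cascading n-sequence, let I = (a, a+1, ..., m) be a lower subinterval of α, and let R_I = (μ₁, ..., μ_n) be the rigged configuration corresponding to the portion of α preceding I. Regarding each rigged partition as having an additional empty row of length 0 and rigging 0 below its last row, define r_a to be the top (longest) row of μ_a and, inductively for a < i <= m, r_i to be the uppermost row of μ_i of length at most |r_{i-1}|. Then every row of μ_m of length greater than |r_m| has the same rigging as r_m, and this common rigging is non-positive and is minimal among the riggings of μ_m. -/

import Mathlib

namespace CascRC

abbrev RP := Multiset (ℕ × ℤ)
abbrev RC := ℕ → RP

/-- The Cartan matrix of type `A`. -/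
def cartanA (a b : ℕ) : ℤ :=
  if a = b then 2 else if b = a + 1 ∨ a = b + 1 then -1 else 0

/-- The smallest rigging of a rigged partition (0 if empty). -/
noncomputable def minRig (ν : RP) : ℤ :=
  if h : ν = 0 then 0
  else (ν.map Prod.snd).toFinset.min'
    (Multiset.toFinset_nonempty.mpr (by simpa [Multiset.map_eq_zero] using h))

/-- The greatest length of a string whose rigging is the smallest rigging. -/
noncomputable def selLen (ν : RP) : ℕ :=
  ((ν.filter (fun s => s.2 = minRig ν)).map Prod.fst).sup

/-- The Kashiwara operator `f_a` on rigged configurations. -/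
noncomputable def fOp (a : ℕ) (R : RC) : RC :=
  if R a = 0 ∨ 0 < minRig (R a) then
    fun b => (if b = a then ({(1, -1)} : RP) else 0)
      + (R b).map (fun s => if 0 < s.1 then (s.1, s.2 - cartanA a b) else s)
  else
    fun b =>
      (if b = a then ({(selLen (R a) + 1, minRig (R a) - 1)} : RP) else 0)
      + ((if b = a then (R a).erase (selLen (R a), minRig (R a)) else R b).map
          (fun s => if selLen (R a) < s.1 then (s.1, s.2 - cartanA a b) else s))

/-- A list `γ` acts by `f_γ = f_{γ_p} ∘ ⋯ ∘ f_{γ₁}`. -/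
noncomputable def fList (γ : List ℕ) (R : RC) : RC :=
  γ.foldl (fun S a => fOp a S) R

def emptyRC : RC := fun _ => 0

/-- `RC(α)`: the result of the list `α` acting on the empty rigged configuration. -/
noncomputable def RCseq (α : List ℕ) : RC := fList α emptyRC

/-- The `m`-lower subinterval `(a, a+1, …, m)`. -/
def lowerInt (a m : ℕ) : List ℕ := List.range' a (m + 1 - a)

def IsLowerIv (n : ℕ) (p : ℕ × ℕ) : Prop := 1 ≤ p.1 ∧ p.1 ≤ p.2 ∧ p.2 ≤ n

/-- Ordering between consecutive lower subintervals in a cascading sequence. -/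
def CascCh (p q : ℕ × ℕ) : Prop := q.2 < p.2 ∨ (q.2 = p.2 ∧ p.1 ≤ q.1)

/-- `ivs` is the lower-subinterval decomposition of a cascading `n`-sequence. -/
def IsCascDecomp (n : ℕ) (ivs : List (ℕ × ℕ)) : Prop :=
  (∀ p ∈ ivs, IsLowerIv n p) ∧ ivs.Chain' CascCh

/-- The integer sequence determined by a decomposition into lower subintervals. -/
def seqOf (ivs : List (ℕ × ℕ)) : List ℕ :=
  (ivs.map (fun p => lowerInt p.1 p.2)).flatten

/-- `R_k`: the rigged configuration corresponding to `I_1 ⋯ I_k`. -/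
noncomputable def Rk (ivs : List (ℕ × ℕ)) (k : ℕ) : RC :=
  RCseq (seqOf (ivs.take k))

/-- Height of column `c` of (the underlying partition of) a rigged partition. -/
def colHt (ν : RP) (c : ℕ) : ℕ := (ν.filter (fun s => c ≤ s.1)).card

/-- Length of the `i`-th row (1-based) of the underlying partition. -/
def rowLen (ν : RP) (i : ℕ) : ℕ :=
  ((Finset.Icc 1 ((ν.map Prod.fst).sup)).filter (fun c => i ≤ colHt ν c)).card

/-- Length of the uppermost row of length at most `L` (0 for the virtual empty row). -/
def upRowLen (ν : RP) (L : ℕ) : ℕ := rowLen ν (colHt ν (L + 1) + 1)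

/-- The column to which an application of `f_a` adds a box. -/
noncomputable def selCol (a : ℕ) (R : RC) : ℕ :=
  if R a = 0 ∨ 0 < minRig (R a) then 1 else selLen (R a) + 1

/-- Given a lower subinterval `p = (a, m)` acting on `R`, the column to which the
operator `f_l` occurring in it adds a box in the `l`-th partition. -/
noncomputable def ivCol (p : ℕ × ℕ) (l : ℕ) (R : RC) : ℕ :=
  selCol l (fList (lowerInt p.1 (l - 1)) R)

/-- Lengths `|r_a|, |r_{a+1}|, …` of the rows `r_i` of Lemma "snake":
`rLenSeq R a (i - a) = |r_i|`. -/
def rLenSeq (R : RC) (a : ℕ) : ℕ → ℕ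
  | 0 => rowLen (R a) 1
  | k + 1 => upRowLen (R (a + k + 1)) (rLenSeq R a k)


/-! ### Column heights and row lengths -/

lemma colHt_antitone (ν : RP) : Antitone (colHt ν) := by
  intro c d h
  exact Multiset.card_le_card (Multiset.monotone_filter_right ν fun s hs => h.trans hs)

lemma colHt_cons (s : ℕ × ℤ) (ν : RP) (c : ℕ) :
    colHt (s ::ₘ ν) c = colHt ν c + if c ≤ s.1 then 1 else 0 := by
  unfold colHt
  split_ifs with h <;> simp [h]

lemma colHt_map (ν : RP) (f : ℕ × ℤ → ℕ × ℤ) (hf : ∀ s, (f s).1 = s.1) (c : ℕ) :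
    colHt (ν.map f) c = colHt ν c := by
  induction ν using Multiset.induction_on with
  | empty => simp
  | cons s t ih => rw [Multiset.map_cons, colHt_cons, colHt_cons, ih, hf]

lemma colHt_lt_of_mem {ν : RP} {s : ℕ × ℤ} (hs : s ∈ ν) {c d : ℕ} (hc : c ≤ s.1)
    (hd : s.1 < d) : colHt ν d < colHt ν c := by
  obtain ⟨t, rfl⟩ := Multiset.exists_cons_of_mem hs
  rw [colHt_cons, colHt_cons, if_pos hc, if_neg (by omega)]
  have := colHt_antitone t (hc.trans hd.le)
  omega

lemma exists_mem_of_colHt_lt {ν : RP} {c : ℕ} (h : colHt ν (c + 1) < colHt ν c) :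
    ∃ s ∈ ν, s.1 = c := by
  by_contra! hne
  refine h.ne' ?_
  unfold colHt
  congr 1
  refine Multiset.filter_congr fun s hs => ?_
  have := hne s hs
  omega

lemma colHt_eq_zero_of_sup_lt {ν : RP} {c : ℕ} (h : (ν.map Prod.fst).sup < c) :
    colHt ν c = 0 := by
  unfold colHt
  rw [Multiset.card_eq_zero, Multiset.filter_eq_nil]
  intro s hs hcs
  have := Multiset.le_sup (Multiset.mem_map_of_mem Prod.fst hs)
  omega

lemma le_rowLen_iff {ν : RP} {i c : ℕ} (hi : 1 ≤ i) (hc : 1 ≤ c) :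
    c ≤ rowLen ν i ↔ i ≤ colHt ν c := by
  unfold rowLen
  constructor
  · intro h
    by_contra! hlt
    have hsub : (Finset.Icc 1 ((ν.map Prod.fst).sup)).filter (fun c => i ≤ colHt ν c)
        ⊆ Finset.Icc 1 (c - 1) := by
      intro d hd
      simp only [Finset.mem_filter, Finset.mem_Icc] at hd ⊢
      refine ⟨hd.1.1, ?_⟩
      by_contra! hcd
      have := colHt_antitone ν (show c ≤ d by omega)
      omega
    have := Finset.card_le_card hsub
    simp only [Nat.card_Icc] at this
    omega
  · intro h
    have hsub : Finset.Icc 1 c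
        ⊆ (Finset.Icc 1 ((ν.map Prod.fst).sup)).filter (fun c => i ≤ colHt ν c) := by
      intro d hd
      simp only [Finset.mem_filter, Finset.mem_Icc] at hd ⊢
      refine ⟨⟨hd.1, ?_⟩, h.trans (colHt_antitone ν hd.2)⟩
      by_contra! hsup
      have := colHt_eq_zero_of_sup_lt (hsup.trans_le hd.2)
      omega
    simpa using Finset.card_le_card hsub

lemma le_upRowLen_iff {ν : RP} {K c : ℕ} (hc : 1 ≤ c) :
    c ≤ upRowLen ν K ↔ colHt ν (K + 1) < colHt ν c :=
  le_rowLen_iff (by omega) hc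

lemma upRowLen_le (ν : RP) (K : ℕ) : upRowLen ν K ≤ K := by
  by_contra! h
  exact lt_irrefl _ ((le_upRowLen_iff (by omega)).1 h)

lemma colHt_upRowLen_succ (ν : RP) (K : ℕ) :
    colHt ν (upRowLen ν K + 1) = colHt ν (K + 1) := by
  refine le_antisymm ?_ (colHt_antitone ν (by have := upRowLen_le ν K; omega))
  by_contra! h
  have := (le_upRowLen_iff (ν := ν) (K := K) (c := upRowLen ν K + 1) (by omega)).2 h
  omega

lemma exists_mem_rowLen {ν : RP} {i : ℕ} (hi : 1 ≤ i) (h : 0 < rowLen ν i) :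
    ∃ s ∈ ν, s.1 = rowLen ν i := by
  refine exists_mem_of_colHt_lt ?_
  have h1 := (le_rowLen_iff (ν := ν) hi h).1 le_rfl
  have h2 := mt (le_rowLen_iff (ν := ν) (c := rowLen ν i + 1) hi (by omega)).2 (by omega)
  omega

lemma colHt_rowLen_one_succ (ν : RP) : colHt ν (rowLen ν 1 + 1) = 0 := by
  have h := mt (le_rowLen_iff (ν := ν) (c := rowLen ν 1 + 1) le_rfl (by omega)).2 (by omega)
  omega

/-! ### The path of rows selected by a lower subinterval -/

/-- The length `|r_i|` of the row of the `i`-th partition on the path starting at `a`. -/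
def pathLen (R : RC) (a i : ℕ) : ℕ := rLenSeq R a (i - a)

lemma pathLen_self (R : RC) (a : ℕ) : pathLen R a a = rowLen (R a) 1 := by
  simp [pathLen, rLenSeq]

lemma pathLen_succ (R : RC) {a i : ℕ} (h : a ≤ i) :
    pathLen R a (i + 1) = upRowLen (R (i + 1)) (pathLen R a i) := by
  obtain ⟨k, rfl⟩ := Nat.exists_eq_add_of_le h
  simp [pathLen, show a + k + 1 - a = k + 1 by omega, rLenSeq]

lemma exists_mem_pathLen {R : RC} {a i : ℕ} (h : a ≤ i) (hpos : 0 < pathLen R a i) :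
    ∃ s ∈ R i, s.1 = pathLen R a i := by
  rcases h.eq_or_lt with rfl | h
  · rw [pathLen_self] at hpos ⊢
    exact exists_mem_rowLen le_rfl hpos
  · obtain ⟨j, rfl⟩ : ∃ j, i = j + 1 := ⟨i - 1, by omega⟩
    rw [pathLen_succ R (by omega)] at hpos ⊢
    exact exists_mem_rowLen (by omega) hpos

/-! ### The Kashiwara operator when the selected string is known -/

lemma exists_mem_minRig {ν : RP} (h : ν ≠ 0) : ∃ s ∈ ν, s.2 = minRig ν := by
  rw [minRig, dif_neg h]
  simpa only [Multiset.mem_toFinset, Multiset.mem_map] using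
    Finset.min'_mem (ν.map Prod.snd).toFinset
      (Multiset.toFinset_nonempty.mpr (by simpa [Multiset.map_eq_zero] using h))

lemma minRig_le {ν : RP} {s : ℕ × ℤ} (hs : s ∈ ν) : minRig ν ≤ s.2 := by
  have h : ν ≠ 0 := fun h => by simp [h] at hs
  rw [minRig, dif_neg h]
  exact Finset.min'_le _ _ (Multiset.mem_toFinset.2 (Multiset.mem_map_of_mem Prod.snd hs))

lemma multiset_sup_mem {t : Multiset ℕ} (h : t ≠ 0) : t.sup ∈ t := by
  induction t using Multiset.induction_on with
  | empty => exact absurd rfl h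
  | cons b t ih =>
    rw [Multiset.sup_cons, Multiset.mem_cons]
    by_cases ht : t = 0
    · simp [ht]
    · rcases le_total b t.sup with hb | hb
      · rw [sup_eq_right.2 hb]
        exact Or.inr (ih ht)
      · exact Or.inl (sup_eq_left.2 hb)

lemma selLen_mem {ν : RP} (h : ν ≠ 0) : (selLen ν, minRig ν) ∈ ν := by
  obtain ⟨s, hs, hsm⟩ := exists_mem_minRig h
  have hne : (ν.filter (fun s => s.2 = minRig ν)).map Prod.fst ≠ 0 := by
    intro h0
    have : s.1 ∈ (ν.filter (fun s => s.2 = minRig ν)).map Prod.fst :=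
      Multiset.mem_map_of_mem Prod.fst (Multiset.mem_filter.2 ⟨hs, hsm⟩)
    simp [h0] at this
  obtain ⟨t, ht, ht1⟩ := Multiset.mem_map.1 (multiset_sup_mem hne)
  obtain ⟨ht, ht2⟩ := Multiset.mem_filter.1 ht
  rwa [show (selLen ν, minRig ν) = t from Prod.ext ht1.symm ht2.symm]

lemma le_selLen {ν : RP} {s : ℕ × ℤ} (hs : s ∈ ν) (h : s.2 = minRig ν) :
    s.1 ≤ selLen ν :=
  Multiset.le_sup (Multiset.mem_map_of_mem Prod.fst (Multiset.mem_filter.2 ⟨hs, h⟩))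

/-- `(K, x)` is a string of `ν`, or the virtual empty row. -/
def IsRow (ν : RP) (K : ℕ) (x : ℤ) : Prop := (K = 0 ∧ x = 0) ∨ (0 < K ∧ (K, x) ∈ ν)

/-- `(K, x)` is the string of `ν` to which the Kashiwara operator adds a box. -/
structure Selects (ν : RP) (K : ℕ) (x : ℤ) : Prop where
  isRow : IsRow ν K x
  nonpos : x ≤ 0
  le : ∀ s ∈ ν, x ≤ s.2
  lt : ∀ s ∈ ν, K < s.1 → x < s.2

/-- Adding `d` to the riggings of all strings longer than `K`. -/
def shift (K : ℕ) (d : ℤ) (s : ℕ × ℤ) : ℕ × ℤ := if K < s.1 then (s.1, s.2 + d) else s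

@[simp] lemma shift_fst (K : ℕ) (d : ℤ) (s : ℕ × ℤ) : (shift K d s).1 = s.1 := by
  unfold shift
  split_ifs <;> rfl

lemma shift_of_lt {K : ℕ} {d : ℤ} {s : ℕ × ℤ} (h : K < s.1) :
    shift K d s = (s.1, s.2 + d) := if_pos h

lemma shift_of_le {K : ℕ} {d : ℤ} {s : ℕ × ℤ} (h : s.1 ≤ K) : shift K d s = s :=
  if_neg (by omega)

lemma shift_zero (K : ℕ) : shift K 0 = id := by
  funext s
  simp [shift]

lemma fOp_of_selects {R : RC} {a K : ℕ} {x : ℤ} (hpos : ∀ s ∈ R a, 1 ≤ s.1)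
    (h : Selects (R a) K x) :
    (∀ b, b ≠ a → fOp a R b = (R b).map (shift K (-cartanA a b))) ∧
    ∃ rest : RP, ((K = 0 ∧ R a = rest) ∨ R a = (K, x) ::ₘ rest) ∧
      fOp a R a = (K + 1, x - 1) ::ₘ rest.map (shift K (-2)) := by
  rcases h.isRow with ⟨rfl, rfl⟩ | ⟨hK, hmem⟩
  · have hcond : R a = 0 ∨ 0 < minRig (R a) := by
      by_cases h0 : R a = 0
      · exact Or.inl h0
      · obtain ⟨s, hs, hsm⟩ := exists_mem_minRig h0
        exact Or.inr (hsm ▸ h.lt s hs (hpos s hs))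
    constructor
    · intro b hb
      simp only [fOp, if_pos hcond, if_neg hb, zero_add]
      rfl
    · refine ⟨R a, Or.inl ⟨rfl, rfl⟩, ?_⟩
      simp only [fOp, if_pos hcond, if_true, Multiset.singleton_add]
      simp only [cartanA, if_true]
      rfl
  · have hne : R a ≠ 0 := fun h0 => by simp [h0] at hmem
    have hmin : minRig (R a) = x := by
      refine le_antisymm (minRig_le hmem) ?_
      obtain ⟨s, hs, hsm⟩ := exists_mem_minRig hne
      exact hsm ▸ h.le s hs
    have hsel : selLen (R a) = K := by
      refine le_antisymm ?_ (le_selLen hmem hmin.symm)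
      by_contra! hlt
      have := h.lt _ (selLen_mem hne) hlt
      simp only at this
      omega
    have hcond : ¬ (R a = 0 ∨ 0 < minRig (R a)) := by
      rw [hmin]
      exact not_or.2 ⟨hne, not_lt.2 h.nonpos⟩
    constructor
    · intro b hb
      simp only [fOp, if_neg hcond, if_neg hb, zero_add, hsel]
      rfl
    · refine ⟨(R a).erase (K, x), Or.inr (Multiset.cons_erase hmem).symm, ?_⟩
      rw [fOp, if_neg hcond]
      simp only [if_true, Multiset.singleton_add, hsel, hmin]
      simp only [cartanA, if_true]
      rfl

lemma colHt_fOp_self {R : RC} {a K : ℕ} {x : ℤ} (hpos : ∀ s ∈ R a, 1 ≤ s.1)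
    (h : Selects (R a) K x) {c : ℕ} (hc : 1 ≤ c) :
    colHt (fOp a R a) c = colHt (R a) c + if c = K + 1 then 1 else 0 := by
  obtain ⟨-, rest, hrest, heq⟩ := fOp_of_selects hpos h
  rw [heq, colHt_cons, colHt_map _ _ (shift_fst _ _)]
  rcases hrest with ⟨rfl, hR⟩ | hR <;> rw [hR]
  · split_ifs <;> omega
  · rw [colHt_cons]
    simp only
    split_ifs <;> omega

/-! ### The action of a lower subinterval -/

/-- The properties of a configuration shared by all stages at which only lower
subintervals ending at most at `m` remain to act. -/
structure Base (R : RC) (m : ℕ) : Prop where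
  pos : ∀ b, ∀ s ∈ R b, 1 ≤ s.1
  rig : ∀ i < m, ∀ s ∈ R i, s.2 = 0
  le : ∀ i < m, ∀ c, 1 ≤ c → colHt (R i) c ≤ colHt (R (i + 1)) c
  le_succ : ∀ i < m, ∀ c, 1 ≤ c → colHt (R (i + 1)) c ≤ colHt (R i) c + 1

/-- All rows longer than `K` have the rigging `x` of the row of length `K`, and `x` is
non-positive and minimal. -/
structure Good (ν : RP) (K : ℕ) (x : ℤ) : Prop where
  isRow : IsRow ν K x
  nonpos : x ≤ 0
  le : ∀ s ∈ ν, x ≤ s.2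
  eq : ∀ s ∈ ν, K < s.1 → s.2 = x

lemma Base.mono {R : RC} {m m' : ℕ} (h : Base R m) (hm : m' ≤ m) : Base R m' :=
  ⟨h.pos, fun i hi => h.rig i (by omega), fun i hi => h.le i (by omega),
    fun i hi => h.le_succ i (by omega)⟩

lemma good_of_rig_zero {R : RC} {a i : ℕ} (ha : a ≤ i) (h : ∀ s ∈ R i, s.2 = 0) :
    Good (R i) (pathLen R a i) 0 := by
  refine ⟨?_, le_rfl, fun s hs => (h s hs).ge, fun s hs _ => h s hs⟩
  rcases Nat.eq_zero_or_pos (pathLen R a i) with h0 | h0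
  · exact Or.inl ⟨h0, rfl⟩
  · obtain ⟨s, hs, hs1⟩ := exists_mem_pathLen ha h0
    exact Or.inr ⟨h0, by rwa [← hs1, ← h s hs]⟩

/-- The interval `(a, …, m)` may act next on `R`. -/
def Ready (R : RC) (a m : ℕ) : Prop := Base R m ∧ ∃ x, Good (R m) (pathLen R a m) x

lemma Ready.good {R : RC} {a m : ℕ} (h : Ready R a m) {i : ℕ} (ha : a ≤ i) (hi : i ≤ m) :
    ∃ x, Good (R i) (pathLen R a i) x ∧ (i < m → x = 0) := by
  rcases hi.eq_or_lt with rfl | hi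
  · obtain ⟨x, hx⟩ := h.2
    exact ⟨x, hx, fun h => absurd h (lt_irrefl _)⟩
  · exact ⟨0, good_of_rig_zero ha (h.1.rig i hi), fun _ => rfl⟩

/-- The configuration `S` is obtained from `R` by the action of `f_a, …, f_i`. -/
structure Partial (R S : RC) (a m i : ℕ) : Prop where
  pos : ∀ b, ∀ s ∈ S b, 1 ≤ s.1
  ht_of_lt : ∀ b < a, ∀ c, 1 ≤ c → colHt (S b) c = colHt (R b) c
  ht : ∀ b, a ≤ b → b ≤ i → ∀ c, 1 ≤ c →
    colHt (S b) c = colHt (R b) c + if c = pathLen R a b + 1 then 1 else 0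
  rig : ∀ b < i, ∀ s ∈ S b, s.2 = 0
  rig_self : ∀ x, Good (R i) (pathLen R a i) x → (i < m → x = 0) →
    ∀ s ∈ S i, x - 1 ≤ s.2 ∧ (pathLen R a i < s.1 → s.2 = x - 1) ∧
      (i < m → s.1 ≤ pathLen R a i → s.2 = 0)
  next : S (i + 1) = (R (i + 1)).map (shift (pathLen R a i) 1)
  far : ∀ b, i + 1 < b → S b = R b

lemma cartanA_succ (a : ℕ) : cartanA a (a + 1) = -1 := by simp [cartanA]

lemma cartanA_pred (a : ℕ) : cartanA (a + 1) a = -1 := by simp [cartanA]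

lemma cartanA_far {a b : ℕ} (h : a + 1 < b ∨ b + 1 < a) : cartanA a b = 0 := by
  unfold cartanA
  rw [if_neg (by omega), if_neg (by omega)]

/-- The effect of `f_i` on the riggings of the `i`-th partition, when the strings longer
than `K` have previously been raised by `e`. -/
lemma rig_fOp_self {R S : RC} {i K K' m : ℕ} {x : ℤ} {e : ℤ}
    (hrig : i < m → ∀ s ∈ R i, s.2 = 0)
    (hpos : ∀ s ∈ S i, 1 ≤ s.1) (hS : S i = (R i).map (shift K' e))
    (hgap : ∀ s ∈ R i, K < s.1 → K' < s.1 ∧ e = 1) (hK : K ≤ K')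
    (hg : Good (R i) K x) (hsel : Selects (S i) K x) :
    ∀ s ∈ fOp i S i, x - 1 ≤ s.2 ∧ (K < s.1 → s.2 = x - 1) ∧
      (i < m → s.1 ≤ K → s.2 = 0) := by
  obtain ⟨-, rest, hrest, heq⟩ := fOp_of_selects hpos hsel
  have hsub : ∀ s ∈ rest, s ∈ S i := by
    intro s hs
    rcases hrest with ⟨-, h⟩ | h <;> rw [h]
    · exact hs
    · exact Multiset.mem_cons_of_mem hs
  intro s hs
  rw [heq, Multiset.mem_cons] at hs
  rcases hs with rfl | hs
  · exact ⟨le_rfl, fun _ => rfl, fun _ h => absurd h (by simp)⟩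
  · obtain ⟨t, ht, rfl⟩ := Multiset.mem_map.1 hs
    have ht' := hsub t ht
    rw [hS] at ht'
    obtain ⟨u, hu, rfl⟩ := Multiset.mem_map.1 ht'
    by_cases hlt : K < u.1
    · obtain ⟨h1, rfl⟩ := hgap u hu hlt
      have := hg.eq u hu hlt
      rw [shift_of_lt (s := shift K' 1 u) (by simpa using hlt), shift_of_lt h1]
      refine ⟨?_, fun _ => ?_, fun _ h => absurd h (by simpa using hlt)⟩ <;> simp only <;> omega
    · rw [shift_of_le (s := shift K' e u) (by simpa using hlt), shift_of_le (by omega)]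
      have := hg.le u hu
      exact ⟨by omega, fun h => absurd h hlt, fun hi _ => hrig hi u hu⟩

lemma selects_of_shift {ν : RP} {K K' : ℕ} {x e : ℤ} (hg : Good ν K x) (he : 0 ≤ e)
    (hgap : ∀ s ∈ ν, K < s.1 → K' < s.1 ∧ e = 1) (hK : K ≤ K') :
    Selects (ν.map (shift K' e)) K x := by
  refine ⟨?_, hg.nonpos, ?_, ?_⟩
  · rcases hg.isRow with h | ⟨h0, h⟩
    · exact Or.inl h
    · refine Or.inr ⟨h0, Multiset.mem_map.2 ⟨_, h, shift_of_le hK⟩⟩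
  · intro s hs
    obtain ⟨t, ht, rfl⟩ := Multiset.mem_map.1 hs
    have := hg.le t ht
    unfold shift
    split_ifs
    · simp only
      omega
    · exact this
  · intro s hs hlt
    obtain ⟨t, ht, rfl⟩ := Multiset.mem_map.1 hs
    rw [shift_fst] at hlt
    obtain ⟨h1, rfl⟩ := hgap t ht hlt
    have := hg.eq t ht hlt
    rw [shift_of_lt h1]
    simp only
    omega

lemma pos_fOp {S : RC} {i K : ℕ} {x : ℤ} (hpos : ∀ b, ∀ s ∈ S b, 1 ≤ s.1)
    (hsel : Selects (S i) K x) : ∀ b, ∀ s ∈ fOp i S b, 1 ≤ s.1 := by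
  obtain ⟨hne, rest, hrest, heq⟩ := fOp_of_selects (hpos i) hsel
  intro b s hs
  by_cases hb : b = i
  · subst hb
    rw [heq, Multiset.mem_cons] at hs
    rcases hs with rfl | hs
    · simp
    · obtain ⟨t, ht, rfl⟩ := Multiset.mem_map.1 hs
      rw [shift_fst]
      refine hpos b t ?_
      rcases hrest with ⟨-, h⟩ | h <;> rw [h]
      · exact ht
      · exact Multiset.mem_cons_of_mem ht
  · rw [hne b hb] at hs
    obtain ⟨t, ht, rfl⟩ := Multiset.mem_map.1 hs
    rw [shift_fst]
    exact hpos b t ht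

lemma not_mem_gap {ν : RP} {c d : ℕ} (h : colHt ν c ≤ colHt ν d) {s : ℕ × ℤ} (hs : s ∈ ν)
    (hc : c ≤ s.1) : d ≤ s.1 := by
  by_contra! hd
  have := colHt_lt_of_mem hs hc hd
  omega

lemma partial_self {R : RC} {a m : ℕ} (ham : a ≤ m) (h : Ready R a m) :
    Partial R (fOp a R) a m a := by
  obtain ⟨x, hg, hx⟩ := h.good le_rfl ham
  have hgap : ∀ s ∈ R a, pathLen R a a < s.1 → pathLen R a a < s.1 ∧ (0 : ℤ) = 1 := by
    intro s hs hlt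
    have := colHt_lt_of_mem (c := pathLen R a a + 1) (d := s.1 + 1) hs hlt (by omega)
    rw [pathLen_self, colHt_rowLen_one_succ] at this
    omega
  have hR : (R a).map (shift (pathLen R a a) 0) = R a := by rw [shift_zero, Multiset.map_id]
  have hsel := selects_of_shift hg le_rfl hgap le_rfl
  rw [hR] at hsel
  have hne := (fOp_of_selects (h.1.pos a) hsel).1
  refine ⟨pos_fOp h.1.pos hsel, ?_, ?_, ?_, ?_, ?_, ?_⟩
  · intro b hb c hc
    rw [hne b hb.ne, colHt_map _ _ (shift_fst _ _)]
  · intro b h1 h2 c hc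
    obtain rfl : b = a := le_antisymm h2 h1
    exact colHt_fOp_self (h.1.pos b) hsel hc
  · intro b hb s hs
    rw [hne b hb.ne] at hs
    obtain ⟨t, ht, rfl⟩ := Multiset.mem_map.1 hs
    have ht0 := h.1.rig b (by omega) t ht
    by_cases hb1 : b + 1 = a
    · subst hb1
      rw [shift_of_le]
      · exact ht0
      · by_contra! hlt
        have h1 := colHt_lt_of_mem (d := t.1 + 1) ht (Nat.succ_le_of_lt hlt) (by omega)
        have h2 := h.1.le b (by omega) (pathLen R (b + 1) (b + 1) + 1) (by omega)
        have h3 := colHt_rowLen_one_succ (R (b + 1))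
        rw [← pathLen_self] at h3
        simp only [Nat.succ_eq_add_one] at h1
        omega
    · rw [cartanA_far (by omega), neg_zero, shift_zero]
      exact ht0
  · intro y hy _
    refine rig_fOp_self (fun hi => h.1.rig a hi) (h.1.pos a) hR.symm hgap le_rfl hy ?_
    have := selects_of_shift hy le_rfl hgap le_rfl
    rwa [hR] at this
  · rw [hne _ (by omega), cartanA_succ, neg_neg]
  · intro b hb
    rw [hne b (by omega), cartanA_far (by omega), neg_zero, shift_zero, Multiset.map_id]

lemma partial_succ {R S : RC} {a m i : ℕ} (hai : a ≤ i) (him : i < m) (h : Ready R a m)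
    (hP : Partial R S a m i) : Partial R (fOp (i + 1) S) a m (i + 1) := by
  set K := pathLen R a i with hKdef
  set K₁ := pathLen R a (i + 1) with hK₁def
  have hK₁ : K₁ = upRowLen (R (i + 1)) K := pathLen_succ R hai
  have hle : K₁ ≤ K := hK₁ ▸ upRowLen_le _ _
  have hht : colHt (R (i + 1)) (K₁ + 1) = colHt (R (i + 1)) (K + 1) :=
    hK₁ ▸ colHt_upRowLen_succ _ _
  have hgap : ∀ s ∈ R (i + 1), K₁ < s.1 → K < s.1 ∧ (1 : ℤ) = 1 := fun s hs hlt =>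
    ⟨not_mem_gap hht.le hs hlt, rfl⟩
  obtain ⟨x, hg, hx⟩ := h.good (i := i + 1) (by omega) him
  have hsel := selects_of_shift hg zero_le_one hgap hle
  rw [← hP.next] at hsel
  have hne := (fOp_of_selects (hP.pos _) hsel).1
  refine ⟨pos_fOp hP.pos hsel, ?_, ?_, ?_, ?_, ?_, ?_⟩
  · intro b hb c hc
    rw [hne b (by omega), colHt_map _ _ (shift_fst _ _), hP.ht_of_lt b hb c hc]
  · intro b h1 h2 c hc
    rcases h2.eq_or_lt with rfl | h2
    · rw [colHt_fOp_self (hP.pos _) hsel hc, hP.next, colHt_map _ _ (shift_fst _ _)]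
    · rw [hne b (by omega), colHt_map _ _ (shift_fst _ _), hP.ht b h1 (by omega) c hc]
  · intro b hb s hs
    rw [hne b (by omega)] at hs
    obtain ⟨t, ht, rfl⟩ := Multiset.mem_map.1 hs
    rcases (Nat.le_of_lt_succ hb).eq_or_lt with rfl | hb
    · rw [cartanA_pred, neg_neg]
      have hz := hP.rig_self 0 (good_of_rig_zero hai (h.1.rig b him)) (fun _ => rfl) t ht
      by_cases hlt : K₁ < t.1
      · have hKt : K < t.1 := by
          refine not_mem_gap (c := K₁ + 1) (d := K + 1) ?_ ht hlt
          rw [hP.ht b hai le_rfl _ (by omega), hP.ht b hai le_rfl _ (by omega), ← hKdef,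
            if_pos rfl]
          rcases hle.eq_or_lt with heq | hlt'
          · rw [heq, if_pos rfl]
          · rw [if_neg (by omega)]
            have h1 := h.1.le b him (K₁ + 1) (by omega)
            have h2 := h.1.le_succ b him (K + 1) (by omega)
            omega
        rw [shift_of_lt hlt]
        have := hz.2.1 hKt
        simp only
        omega
      · rw [shift_of_le (by omega)]
        exact hz.2.2 him (by omega)
    · rw [cartanA_far (by omega), neg_zero, shift_zero]
      exact hP.rig b hb t ht
  · intro y hy _
    refine rig_fOp_self (fun hi => h.1.rig _ hi) (hP.pos _) hP.next hgap hle hy ?_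
    have := selects_of_shift hy zero_le_one hgap hle
    rwa [← hP.next] at this
  · rw [hne _ (by omega), cartanA_succ, neg_neg, hP.far _ (by omega)]
  · intro b hb
    rw [hne b (by omega), cartanA_far (by omega), neg_zero, shift_zero, Multiset.map_id,
      hP.far b (by omega)]

lemma fList_append (γ δ : List ℕ) (R : RC) : fList (γ ++ δ) R = fList δ (fList γ R) :=
  List.foldl_append

lemma lowerInt_self (a : ℕ) : lowerInt a a = [a] := by
  simp [lowerInt]

lemma lowerInt_succ {a i : ℕ} (h : a ≤ i) : lowerInt a (i + 1) = lowerInt a i ++ [i + 1] := by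
  unfold lowerInt
  rw [show i + 1 + 1 - a = (i + 1 - a) + 1 by omega, List.range'_1_concat,
    show a + (i + 1 - a) = i + 1 by omega]

lemma partial_lowerInt {R : RC} {a m i : ℕ} (hai : a ≤ i) (him : i ≤ m) (h : Ready R a m) :
    Partial R (fList (lowerInt a i) R) a m i := by
  induction i, hai using Nat.le_induction with
  | base =>
    rw [lowerInt_self]
    exact partial_self him h
  | succ j hj ih =>
    rw [lowerInt_succ hj, fList_append]
    exact partial_succ hj him h (ih (by omega))

/-! ### Preservation of the invariant -/

lemma Partial.base {R S : RC} {a m : ℕ} (h : Ready R a m) (hP : Partial R S a m m) :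
    Base S m := by
  have key : ∀ i < m, ∀ c, 1 ≤ c →
      colHt (S i) c ≤ colHt (S (i + 1)) c ∧ colHt (S (i + 1)) c ≤ colHt (S i) c + 1 := by
    intro i hi c hc
    have h1 := h.1.le i hi c hc
    have h2 := h.1.le_succ i hi c hc
    rcases lt_trichotomy (i + 1) a with hia | hia | hia
    · rw [hP.ht_of_lt i (by omega) c hc, hP.ht_of_lt (i + 1) hia c hc]
      exact ⟨h1, h2⟩
    · subst hia
      rw [hP.ht_of_lt i (by omega) c hc, hP.ht (i + 1) le_rfl hi c hc]
      split_ifs with hcK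
      · have h3 := colHt_rowLen_one_succ (R (i + 1))
        rw [← pathLen_self, ← hcK] at h3
        omega
      · omega
    · have hai : a ≤ i := by omega
      rw [hP.ht i hai hi.le c hc, hP.ht (i + 1) hia.le hi c hc, pathLen_succ R hai]
      have hrow := exists_mem_pathLen (R := R) hai
      set K := pathLen R a i
      have hle := upRowLen_le (R (i + 1)) K
      have hht := colHt_upRowLen_succ (R (i + 1)) K
      set K₁ := upRowLen (R (i + 1)) K
      rcases hle.eq_or_lt with heq | hlt
      · rw [heq]
        omega
      · obtain ⟨s, hs, hsK⟩ := hrow (by omega)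
        have hdrop := colHt_lt_of_mem (c := K) (d := K + 1) hs hsK.ge (by omega)
        have hanti := colHt_antitone (R i) (show K₁ + 1 ≤ K by omega)
        have hanti' := colHt_antitone (R (i + 1)) (show K₁ + 1 ≤ K by omega)
        have hanti'' := colHt_antitone (R (i + 1)) (show K ≤ K + 1 by omega)
        have h3 := h.1.le i hi K (by omega)
        have h4 := h.1.le_succ i hi (K + 1) (by omega)
        split_ifs with hc1 hc2 hc2
        · omega
        · subst hc1
          omega
        · subst hc2
          omega
        · omega
  exact ⟨hP.pos, hP.rig, fun i hi c hc => (key i hi c hc).1, fun i hi c hc => (key i hi c hc).2⟩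

lemma Partial.pathLen_lt {R S : RC} {a m : ℕ} (hP : Partial R S a m m) {a' j : ℕ}
    (haa : a ≤ a') (haj : a' ≤ j) (hjm : j ≤ m) : pathLen R a j < pathLen S a' j := by
  induction j, haj using Nat.le_induction with
  | base =>
    rw [pathLen_self]
    refine (le_rowLen_iff le_rfl (Nat.succ_pos _)).2 ?_
    rw [hP.ht a' haa hjm _ (Nat.succ_pos _), if_pos rfl]
    omega
  | succ j hj ih =>
    have hlt := ih (by omega)
    rw [pathLen_succ S hj]
    refine (le_upRowLen_iff (Nat.succ_pos _)).2 ?_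
    have hle : pathLen R a (j + 1) ≤ pathLen R a j := by
      rw [pathLen_succ R (by omega)]
      exact upRowLen_le _ _
    rw [hP.ht (j + 1) (by omega) hjm _ (Nat.succ_pos _), if_neg (by omega),
      hP.ht (j + 1) (by omega) hjm _ (Nat.succ_pos _), if_pos rfl]
    exact Nat.lt_succ_of_le (colHt_antitone _ (by omega))

lemma ready_fList_lowerInt {R : RC} {a m a' m' : ℕ} (ham : a ≤ m) (h : Ready R a m)
    (ham' : a' ≤ m') (hch : CascCh (a, m) (a', m')) :
    Ready (fList (lowerInt a m) R) a' m' := by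
  have hP := partial_lowerInt ham le_rfl h
  have hB := hP.base h
  rcases hch with hlt | ⟨heq, haa⟩
  · exact ⟨hB.mono (le_of_lt hlt), 0, good_of_rig_zero ham' (hB.rig m' hlt)⟩
  · obtain rfl : m' = m := heq
    obtain ⟨x, hg, hx⟩ := h.good ham le_rfl
    have hrig := hP.rig_self x hg hx
    have hlt := hP.pathLen_lt (a' := a') haa ham' le_rfl
    have hnonpos := hg.nonpos
    refine ⟨hB, x - 1, ?_, by omega, fun s hs => (hrig s hs).1,
      fun s hs hs1 => (hrig s hs).2.1 (by omega)⟩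
    obtain ⟨s, hs, hs1⟩ := exists_mem_pathLen (R := fList (lowerInt a m') R) ham' (by omega)
    refine Or.inr ⟨by omega, ?_⟩
    rw [← hs1, ← (hrig s hs).2.1 (by omega)]
    exact hs

lemma ready_emptyRC {a m : ℕ} (ham : a ≤ m) : Ready emptyRC a m := by
  refine ⟨⟨?_, ?_, ?_, ?_⟩, 0, good_of_rig_zero ham ?_⟩ <;> simp [emptyRC, colHt]

lemma Rk_succ (ivs : List (ℕ × ℕ)) (k : ℕ) (hk : k < ivs.length) :
    Rk ivs (k + 1) = fList (lowerInt ivs[k].1 ivs[k].2) (Rk ivs k) := by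
  unfold Rk RCseq seqOf
  rw [← List.take_concat_get' _ _ hk, List.map_append, List.flatten_append, fList_append]
  simp

lemma ready_Rk {n : ℕ} {ivs : List (ℕ × ℕ)} (hc : IsCascDecomp n ivs) (k : ℕ)
    (hk : k < ivs.length) : Ready (Rk ivs k) ivs[k].1 ivs[k].2 := by
  induction k with
  | zero =>
    simpa [Rk, RCseq, seqOf, fList] using
      ready_emptyRC (hc.1 _ (List.getElem_mem hk)).2.1
  | succ k ih =>
    rw [Rk_succ ivs k (by omega)]
    exact ready_fList_lowerInt (hc.1 _ (List.getElem_mem _)).2.1 (ih (by omega))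
      (hc.1 _ (List.getElem_mem _)).2.1 (List.isChain_iff_getElem.1 hc.2 k hk)

/-- part of the Main Lemma.
With `I = I_{k+1} = (a, …, m)` (0-based `k`) and `R_I = R_k = (μ₁, …, μ_n)`, define
`r_a` to be the top row of `μ_a` and, inductively, `r_i` the uppermost row of `μ_i`
of length at most `|r_{i-1}|` (with a virtual empty row of length 0 and rigging 0
below every partition); so `|r_i| = rLenSeq (Rk ivs k) a (i - a)`.  Then there is a
rigging `x` of the row `r_m` (with `x = 0` if `r_m` is the virtual empty row) such
that every row of `μ_m` of length greater than `|r_m|` has rigging `x`, and `x` is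
non-positive and minimal among the riggings of `μ_m`. -/
theorem mainLemma_rigging_of_rm (n : ℕ) (hn : 0 < n)
    (ivs : List (ℕ × ℕ)) (hc : IsCascDecomp n ivs)
    (k : ℕ) (hk : k < ivs.length) (a m : ℕ) (hiv : ivs[k]'hk = (a, m))
    (L : ℕ) (hL : L = rLenSeq (Rk ivs k) a (m - a)) :
    ∃ x : ℤ,
      ((L = 0 ∧ x = 0) ∨ (0 < L ∧ (L, x) ∈ Rk ivs k m)) ∧
      x ≤ 0 ∧
      (∀ s ∈ Rk ivs k m, x ≤ s.2) ∧
      (∀ s ∈ Rk ivs k m, L < s.1 → s.2 = x) := by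
  have h := ready_Rk hc k hk
  rw [hiv] at h
  obtain ⟨-, x, hg⟩ := h
  subst hL
  exact ⟨x, hg.isRow, hg.nonpos, hg.le, hg.eq⟩

end CascRC
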